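/- Let G be a finitely generated virtually free group with finite generating set A and word metric d_A, and let H be a subgroup of G. Then H is quasi-convex with respect to A if and only if H is finitely generated. -/

import Mathlib

/-- The word metric associated with a generating set `A` of a group `G`:
`wordDist A g h` is the least `n` such that `g⁻¹h` is a product of `n` elements
of `A ∪ A⁻¹`. -/
noncomputable def wordDist {G : Type*} [Group G] (A : Set G) (g h : G) : ℕ :=
  sInf { n : ℕ | ∃ l : List G, l.length = n ∧ (∀ x ∈ l, x ∈ A ∪ A⁻¹) ∧ l.prod = g⁻¹ * h }

/-- A group is virtually free if it has a free subgroup of finite index. -/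
def VirtuallyFree (G : Type*) [Group G] : Prop :=
  ∃ H : Subgroup G, H.FiniteIndex ∧ IsFreeGroup H
/-- `γ 0, γ 1, …, γ m` is a discrete geodesic for the word metric of `A`:
`d_A(γ i, γ j) = |i − j|` for all `i, j ≤ m`. -/
def IsDiscGeodesic {G : Type*} [Group G] (A : Set G) (γ : ℕ → G) (m : ℕ) : Prop :=
  ∀ i ≤ m, ∀ j ≤ m, (wordDist A (γ i) (γ j) : ℤ) = |(i : ℤ) - (j : ℤ)|

/-- `γ 0, γ 1, …, γ m` is a discrete path for the word metric of `A`: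
consecutive vertices are at distance at most `1`. -/
def IsDiscPath {G : Type*} [Group G] (A : Set G) (γ : ℕ → G) (m : ℕ) : Prop :=
  ∀ i < m, wordDist A (γ i) (γ (i + 1)) ≤ 1

/-- The point `p` separates `u` from `v` in the Cayley tree of the free group: `u` and `v` do not
lie in a common branch at `p`. -/
def FreeGroup.Separates {X : Type*} [DecidableEq X] (p u v : FreeGroup X) : Prop :=
  ∀ c, c ∈ (p⁻¹ * u).toWord.head? → c ∉ (p⁻¹ * v).toWord.head?

/-- Every path from `u` to `v` with steps in `B` meets the translate `p D`. -/
def CoarselySeparates {G : Type*} [Group G] (B D : Set G) (p u v : G) : Prop :=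
  ∀ (β : ℕ → G) (n : ℕ), β 0 = u → β n = v → (∀ i < n, (β i)⁻¹ * β (i + 1) ∈ B) →
    ∃ i ≤ n, p⁻¹ * β i ∈ D

namespace FreeGroup

variable {X : Type*} [DecidableEq X]

theorem norm_inv_mk_singleton_mul_lt {w : FreeGroup X} {c : X × Bool}
    (h : c ∈ w.toWord.head?) : norm ((mk [c])⁻¹ * w) < norm w := by
  obtain ⟨L, hL⟩ : ∃ L, w.toWord = c :: L := List.head?_eq_some_iff.mp h
  have hw : w = mk [c] * mk L := by
    rw [mul_mk, List.singleton_append, ← hL, mk_toWord]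
  have h1 : norm w = L.length + 1 := by rw [norm, hL, List.length_cons]
  have h2 : (mk [c])⁻¹ * w = mk L := by rw [hw, inv_mul_cancel_left]
  rw [h2, h1]
  exact Nat.lt_succ_of_le norm_mk_le

theorem norm_inv_mk_singleton_mul_le (w : FreeGroup X) (c : X × Bool) :
    norm ((mk [c])⁻¹ * w) ≤ norm w + 1 := by
  have h1 := norm_mul_le (mk [c])⁻¹ w
  have h2 : norm (mk [c]) ≤ 1 := norm_mk_le
  rw [norm_inv_eq] at h1
  omega

/-- Any three points of a free group have a median. -/
theorem exists_separates (x y z : FreeGroup X) :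
    ∃ p, Separates p x y ∧ Separates p y z ∧ Separates p x z := by
  let f : FreeGroup X → ℕ := fun p => norm (p⁻¹ * x) + norm (p⁻¹ * y) + norm (p⁻¹ * z)
  obtain ⟨_, ⟨p, rfl⟩, hp⟩ := WellFounded.has_min wellFounded_lt (Set.range f) ⟨_, ⟨1, rfl⟩⟩
  have hmin : ∀ c, ¬ f (p * mk [c]) < f p := fun c => hp _ ⟨_, rfl⟩
  simp only [f, mul_inv_rev, mul_assoc] at hmin
  refine ⟨p, fun c h1 h2 => hmin c ?_, fun c h1 h2 => hmin c ?_, fun c h1 h2 => hmin c ?_⟩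
  · have h3 := norm_inv_mk_singleton_mul_le (p⁻¹ * z) c
    have h1 := norm_inv_mk_singleton_mul_lt h1
    have h2 := norm_inv_mk_singleton_mul_lt h2
    omega
  · have h3 := norm_inv_mk_singleton_mul_le (p⁻¹ * x) c
    have h1 := norm_inv_mk_singleton_mul_lt h1
    have h2 := norm_inv_mk_singleton_mul_lt h2
    omega
  · have h3 := norm_inv_mk_singleton_mul_le (p⁻¹ * y) c
    have h1 := norm_inv_mk_singleton_mul_lt h1
    have h2 := norm_inv_mk_singleton_mul_lt h2
    omega

theorem toWord_inv_mul_of_head?_ne {u v : FreeGroup X} (h : u.toWord.head? ≠ v.toWord.head?) :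
    (u⁻¹ * v).toWord = u⁻¹.toWord ++ v.toWord := by
  rw [toWord_mul]
  apply IsReduced.reduce_eq
  refine List.isChain_append.mpr ⟨isReduced_toWord, isReduced_toWord, ?_⟩
  intro a ha b hb hab
  rw [toWord_inv, invRev, List.getLast?_reverse, List.head?_map, Option.mem_def,
    Option.map_eq_some_iff] at ha
  obtain ⟨c, hc, rfl⟩ := ha
  by_contra hne
  have hcb : c = b := Prod.ext hab (by simpa using hne)
  subst hcb
  exact h (hc.trans (Option.mem_def.mp hb).symm)

theorem finite_setOf_head?_ne {K : Set (FreeGroup X)} (hK : K.Finite) :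
    {u : FreeGroup X | ∃ v, u⁻¹ * v ∈ K ∧ u.toWord.head? ≠ v.toWord.head?}.Finite := by
  refine (hK.biUnion fun k _ =>
    (k.toWord.inits.toFinset.finite_toSet.image fun l => (mk l)⁻¹)).subset ?_
  rintro u ⟨v, hk, hne⟩
  refine Set.mem_biUnion hk ⟨u⁻¹.toWord, ?_, by simp only [mk_toWord, inv_inv]⟩
  simp [toWord_inv_mul_of_head?_ne hne]

theorem exists_finite_forall_coarselySeparates {K : Set (FreeGroup X)} (hK : K.Finite) :
    ∃ D : Set (FreeGroup X), D.Finite ∧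
      ∀ p u v, Separates p u v → CoarselySeparates K D p u v := by
  refine ⟨insert 1 {u | ∃ v, u⁻¹ * v ∈ K ∧ u.toWord.head? ≠ v.toWord.head?},
    (finite_setOf_head?_ne hK).insert 1, ?_⟩
  intro p u v hsep β n h0 hn hstep
  by_contra! hfar
  have hconst : ∀ i ≤ n, (p⁻¹ * β i).toWord.head? = (p⁻¹ * β 0).toWord.head? := by
    intro i
    induction i with
    | zero => exact fun _ => rfl
    | succ i ih =>
      intro hi
      rw [← ih (by omega)]
      by_contra hne
      refine hfar i (by omega) (Or.inr ⟨p⁻¹ * β (i + 1), ?_, Ne.symm hne⟩)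
      simpa [mul_assoc] using hstep i (by omega)
  have hend := hconst n le_rfl
  rw [h0, hn] at hend
  cases hc : (p⁻¹ * u).toWord.head? with
  | none =>
    rw [List.head?_eq_none_iff, toWord_eq_nil_iff] at hc
    exact hfar 0 (Nat.zero_le n) (Or.inl (h0 ▸ hc))
  | some c => exact hsep c hc (hend.trans hc)

end FreeGroup

open scoped Pointwise in
/-- Coarse medians exist in a virtually free group. -/
theorem VirtuallyFree.exists_coarselySeparates {G : Type*} [Group G] (hVF : VirtuallyFree G)
    {B : Set G} (hB : B.Finite) :
    ∃ D : Set G, D.Finite ∧ ∀ x y z : G, ∃ p, CoarselySeparates B D p x y ∧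
      CoarselySeparates B D p y z ∧ CoarselySeparates B D p x z := by
  classical
  obtain ⟨F, hF, hfree⟩ := hVF
  have : Finite (G ⧸ F) := inferInstance
  let ψ : FreeGroup (IsFreeGroup.Generators F) →* G :=
    F.subtype.comp (IsFreeGroup.toFreeGroup F).symm.toMonoidHom
  have hψ : Function.Injective ψ :=
    F.subtype_injective.comp (IsFreeGroup.toFreeGroup F).symm.injective
  obtain ⟨T, hT, hφ⟩ : ∃ T : Set G, T.Finite ∧ ∀ g : G, ∃ f, (ψ f)⁻¹ * g ∈ T := by
    refine ⟨(Set.range fun c : G ⧸ F => c.out)⁻¹, (Set.finite_range _).inv, fun g => ?_⟩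
    obtain ⟨f, hf⟩ := QuotientGroup.mk_out_eq_mul F g⁻¹
    refine ⟨IsFreeGroup.toFreeGroup F f, ?_⟩
    have : ψ (IsFreeGroup.toFreeGroup F f) = f := by simp [ψ]
    rw [this, Set.mem_inv, mul_inv_rev, inv_inv, ← hf]
    exact ⟨_, rfl⟩
  choose φ hφ using hφ
  have hK : (ψ ⁻¹' (T * B * T⁻¹)).Finite :=
    ((hT.mul hB).mul hT.inv).preimage hψ.injOn
  obtain ⟨D, hD, hsep⟩ := FreeGroup.exists_finite_forall_coarselySeparates hK
  have key : ∀ p u v, FreeGroup.Separates p (φ u) (φ v) →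
      CoarselySeparates B (ψ '' D * T) (ψ p) u v := by
    intro p u v h β n h0 hn hstep
    obtain ⟨i, hi, hiD⟩ := hsep _ _ _ h (fun i => φ (β i)) n (by rw [h0]) (by rw [hn]) <| by
      intro i hi
      refine ⟨_, ⟨_, hφ (β i), _, hstep i hi, rfl⟩, ((ψ (φ (β (i + 1))))⁻¹ * β (i + 1))⁻¹,
        Set.inv_mem_inv.mpr (hφ _), ?_⟩
      simp only [map_mul, map_inv]
      group
    refine ⟨i, hi, _, ⟨_, hiD, rfl⟩, _, hφ (β i), ?_⟩
    simp only [map_mul, map_inv]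
    group
  refine ⟨ψ '' D * T, (hD.image ψ).mul hT, fun x y z => ?_⟩
  obtain ⟨p, h1, h2, h3⟩ := FreeGroup.exists_separates (φ x) (φ y) (φ z)
  exact ⟨ψ p, key _ _ _ h1, key _ _ _ h2, key _ _ _ h3⟩

section WordMetric

variable {G : Type*} [Group G] {A : Set G}

theorem Subgroup.exists_list_of_mem_closure {g : G} (hg : g ∈ Subgroup.closure A) :
    ∃ l : List G, (∀ x ∈ l, x ∈ A ∪ A⁻¹) ∧ l.prod = g := by
  rw [← Subgroup.mem_toSubmonoid, Subgroup.closure_toSubmonoid] at hg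
  exact Submonoid.exists_list_of_mem_closure hg

theorem wordDist_le {g h : G} {l : List G} (hl : ∀ x ∈ l, x ∈ A ∪ A⁻¹)
    (hp : l.prod = g⁻¹ * h) : wordDist A g h ≤ l.length :=
  Nat.sInf_le ⟨l, rfl, hl, hp⟩

theorem exists_list_length_eq_wordDist (hgen : Subgroup.closure A = ⊤) (g h : G) :
    ∃ l : List G, l.length = wordDist A g h ∧ (∀ x ∈ l, x ∈ A ∪ A⁻¹) ∧ l.prod = g⁻¹ * h := by
  obtain ⟨l, hl, hp⟩ := Subgroup.exists_list_of_mem_closure (A := A) (g := g⁻¹ * h) (hgen ▸ trivial)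
  exact Nat.sInf_mem (s := {n | ∃ l : List G, l.length = n ∧ (∀ x ∈ l, x ∈ A ∪ A⁻¹) ∧
    l.prod = g⁻¹ * h}) ⟨_, l, rfl, hl, hp⟩

theorem wordDist_eq_wordDist_one (g h : G) : wordDist A g h = wordDist A 1 (g⁻¹ * h) := by
  simp [wordDist]

theorem wordDist_self (g : G) : wordDist A g g = 0 :=
  Nat.le_zero.mp (wordDist_le (l := []) (by simp) (by simp))

theorem wordDist_triangle (hgen : Subgroup.closure A = ⊤) (a b c : G) :
    wordDist A a c ≤ wordDist A a b + wordDist A b c := by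
  obtain ⟨l, hl, hlA, hlp⟩ := exists_list_length_eq_wordDist hgen a b
  obtain ⟨l', hl', hlA', hlp'⟩ := exists_list_length_eq_wordDist hgen b c
  rw [← hl, ← hl', ← List.length_append]
  refine wordDist_le (fun x hx => ?_) ?_
  · exact (List.mem_append.mp hx).elim (hlA x) (hlA' x)
  · rw [List.prod_append, hlp, hlp']; group

theorem wordDist_comm (hgen : Subgroup.closure A = ⊤) (a b : G) :
    wordDist A a b = wordDist A b a := by
  suffices h : ∀ a b : G, wordDist A a b ≤ wordDist A b a from le_antisymm (h a b) (h b a)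
  intro a b
  obtain ⟨l, hl, hlA, hlp⟩ := exists_list_length_eq_wordDist hgen b a
  have := wordDist_le (A := A) (g := a) (h := b) (l := (l.map fun x => x⁻¹).reverse) ?_ ?_
  · simpa [hl] using this
  · intro x hx
    simp only [List.mem_reverse, List.mem_map] at hx
    obtain ⟨y, hy, rfl⟩ := hx
    simpa [or_comm] using hlA y hy
  · rw [← List.prod_inv_reverse, hlp]; group

open scoped Pointwise in
theorem finite_setOf_wordDist_le (hA : A.Finite) (hgen : Subgroup.closure A = ⊤) (N : ℕ) :
    {g : G | wordDist A 1 g ≤ N}.Finite := by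
  suffices h : ∀ N, {g : G | ∃ l : List G, l.length = N ∧ (∀ x ∈ l, x ∈ A ∪ A⁻¹) ∧
      l.prod = g}.Finite by
    refine ((Set.finite_Iic N).biUnion fun n _ => h n).subset fun g hg => ?_
    obtain ⟨l, hl, hlA, hlp⟩ := exists_list_length_eq_wordDist hgen 1 g
    exact Set.mem_biUnion (Set.mem_Iic.mpr hg) ⟨l, hl, hlA, by simpa using hlp⟩
  intro N
  induction N with
  | zero =>
    refine (Set.finite_singleton (1 : G)).subset ?_
    rintro g ⟨l, hl, -, rfl⟩
    simp [List.length_eq_zero_iff.mp hl]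
  | succ N ih =>
    refine ((hA.union hA.inv).mul ih).subset ?_
    rintro g ⟨l, hl, hlA, rfl⟩
    obtain ⟨a, l, rfl⟩ := List.exists_cons_of_length_eq_add_one hl
    rw [List.prod_cons]
    exact Set.mul_mem_mul (hlA a (by simp))
      ⟨l, by simpa using hl, fun x hx => hlA x (by simp [hx]), rfl⟩

theorem inv_mul_mem_of_wordDist_eq_one (hgen : Subgroup.closure A = ⊤) {a b : G}
    (h : wordDist A a b = 1) : a⁻¹ * b ∈ A ∪ A⁻¹ := by
  obtain ⟨l, hl, hlA, hlp⟩ := exists_list_length_eq_wordDist hgen a b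
  obtain ⟨x, rfl⟩ := List.length_eq_one_iff.mp (hl.trans h)
  rw [← hlp, List.prod_singleton]
  exact hlA x (by simp)

theorem IsDiscGeodesic.wordDist_eq {γ : ℕ → G} {m : ℕ} (hγ : IsDiscGeodesic A γ m) {i j : ℕ}
    (hij : i ≤ j) (hj : j ≤ m) : wordDist A (γ i) (γ j) = j - i := by
  have := hγ i (hij.trans hj) j hj
  rw [abs_of_nonpos (by omega)] at this
  omega

theorem exists_isDiscGeodesic (hgen : Subgroup.closure A = ⊤) (g : G) :
    ∃ (γ : ℕ → G) (m : ℕ), IsDiscGeodesic A γ m ∧ γ 0 = 1 ∧ γ m = g := by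
  obtain ⟨l, hl, hlA, hlp⟩ := exists_list_length_eq_wordDist hgen 1 g
  have hend : (l.take l.length).prod = g := by simpa using hlp
  have hle : ∀ i j, i ≤ j → wordDist A (l.take i).prod (l.take j).prod ≤ j - i := by
    intro i j hij
    have := wordDist_le (A := A) (g := (l.take i).prod) (h := (l.take j).prod)
      (l := (l.take j).drop i)
      (fun x hx => hlA x (List.mem_of_mem_take (List.mem_of_mem_drop hx))) ?_
    · refine this.trans ?_
      simp only [List.length_drop, List.length_take]
      omega
    · have h := List.prod_take_mul_prod_drop (l.take j) i
      rw [List.take_take, min_eq_left hij] at h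
      rw [← h, inv_mul_cancel_left]
  have heq : ∀ i j, i ≤ j → j ≤ l.length →
      wordDist A (l.take i).prod (l.take j).prod = j - i := by
    intro i j hij hj
    have h1 := hle i j hij
    have h2 := hle 0 i (Nat.zero_le i)
    have h3 := hle j l.length hj
    have h4 := wordDist_triangle hgen (l.take 0).prod (l.take i).prod (l.take l.length).prod
    have h5 := wordDist_triangle hgen (l.take i).prod (l.take j).prod (l.take l.length).prod
    rw [hend] at h3 h4 h5
    rw [List.take_zero, List.prod_nil] at h2 h4
    omega
  refine ⟨fun i => (l.take i).prod, l.length, fun i hi j hj => ?_, by simp, hend⟩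
  rcases le_total i j with hij | hij
  · rw [heq i j hij hj, abs_of_nonpos (by omega)]
    omega
  · rw [wordDist_comm hgen, heq j i hij hi, abs_of_nonneg (by omega)]
    omega

theorem fg_of_forall_isDiscGeodesic (hA : A.Finite) (hgen : Subgroup.closure A = ⊤)
    {H : Subgroup G} {N : ℕ} (hq : ∀ (γ : ℕ → G) (m : ℕ), IsDiscGeodesic A γ m →
      γ 0 ∈ H → γ m ∈ H → ∀ i ≤ m, ∃ h ∈ H, wordDist A (γ i) h ≤ N) : H.FG := by
  rw [Subgroup.fg_iff]
  refine ⟨{h | h ∈ H ∧ wordDist A 1 h ≤ N + 1 + N}, ?_,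
    (finite_setOf_wordDist_le hA hgen _).subset fun h hh => hh.2⟩
  refine le_antisymm ((Subgroup.closure_le _).mpr fun h hh => hh.1) fun h hh => ?_
  set K := Subgroup.closure {h | h ∈ H ∧ wordDist A 1 h ≤ N + 1 + N}
  obtain ⟨γ, m, hγ, h0, hm⟩ := exists_isDiscGeodesic hgen h
  have hnear := hq γ m hγ (h0 ▸ H.one_mem) (hm ▸ hh)
  have hmem : ∀ i ≤ m, ∀ k ∈ H, wordDist A (γ i) k ≤ N → k ∈ K := by
    intro i
    induction i with
    | zero =>
      intro _ k hk hd
      rw [h0] at hd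
      exact Subgroup.subset_closure ⟨hk, by omega⟩
    | succ i ih =>
      intro hi k hk hd
      obtain ⟨k', hk', hd'⟩ := hnear i (by omega)
      have hkK := ih (by omega) k' hk' hd'
      have h1 := wordDist_triangle hgen k' (γ i) k
      have h2 := wordDist_triangle hgen (γ i) (γ (i + 1)) k
      rw [wordDist_comm hgen k' (γ i)] at h1
      rw [hγ.wordDist_eq (Nat.le_succ i) hi] at h2
      have h3 : k'⁻¹ * k ∈ K := Subgroup.subset_closure
        ⟨H.mul_mem (H.inv_mem hk') hk, by rw [← wordDist_eq_wordDist_one]; omega⟩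
      simpa using K.mul_mem hkK h3
  exact hmem m le_rfl h hh (by rw [hm, wordDist_self]; exact Nat.zero_le N)

theorem exists_path_of_mem_closure {S : Set G} {x y : G}
    (hx : x ∈ Subgroup.closure S) (hy : y ∈ Subgroup.closure S) :
    ∃ (β : ℕ → G) (n : ℕ), β 0 = x ∧ β n = y ∧ (∀ i < n, (β i)⁻¹ * β (i + 1) ∈ S ∪ S⁻¹) ∧
      ∀ i, β i ∈ Subgroup.closure S := by
  obtain ⟨l, hl, hp⟩ := Subgroup.exists_list_of_mem_closure (mul_mem (inv_mem hx) hy)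
  refine ⟨fun i => x * (l.take i).prod, l.length, by simp, by simp [hp], fun i hi => ?_,
    fun i => mul_mem hx (list_prod_mem fun s hs => ?_)⟩
  · have hs : (x * (l.take i).prod)⁻¹ * (x * (l.take (i + 1)).prod) = l[i] := by
      rw [List.prod_take_succ l i hi]; group
    rw [hs]
    exact hl _ (List.getElem_mem hi)
  · rcases hl s (List.mem_of_mem_take hs) with h | h
    · exact Subgroup.subset_closure h
    · exact (Subgroup.inv_mem_iff _).mp (Subgroup.subset_closure h)

open scoped Pointwise in
theorem VirtuallyFree.exists_wordDist_le_of_fg (hVF : VirtuallyFree G) (hA : A.Finite)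
    (hgen : Subgroup.closure A = ⊤) {H : Subgroup G} (hH : H.FG) :
    ∃ N : ℕ, ∀ (γ : ℕ → G) (m : ℕ), IsDiscGeodesic A γ m →
      γ 0 ∈ H → γ m ∈ H → ∀ i ≤ m, ∃ h ∈ H, wordDist A (γ i) h ≤ N := by
  obtain ⟨S, rfl, hS⟩ := (Subgroup.fg_iff H).mp hH
  obtain ⟨D, hD, hsep⟩ := hVF.exists_coarselySeparates
    ((hA.union hA.inv).union (hS.union hS.inv))
  obtain ⟨C, hC⟩ := ((hD.inv.mul hD).image (wordDist A 1)).bddAbove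
  have hnear : ∀ {p u v : G}, p⁻¹ * u ∈ D → p⁻¹ * v ∈ D → wordDist A u v ≤ C := by
    intro p u v hu hv
    rw [wordDist_eq_wordDist_one]
    refine hC ⟨_, ⟨_, Set.inv_mem_inv.mpr hu, _, hv, ?_⟩, rfl⟩
    group
  refine ⟨C + C, fun γ m hγ h0 hm k hk => ?_⟩
  have hstep : ∀ i < m, (γ i)⁻¹ * γ (i + 1) ∈ (A ∪ A⁻¹) ∪ (S ∪ S⁻¹) := fun i hi =>
    Or.inl (inv_mul_mem_of_wordDist_eq_one hgen
      ((hγ.wordDist_eq (Nat.le_succ i) hi).trans (by omega)))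
  obtain ⟨β, n, hβ0, hβn, hβ, hβS⟩ := exists_path_of_mem_closure h0 hm
  obtain ⟨p, h1, h2, h3⟩ := hsep (γ 0) (γ k) (γ m)
  obtain ⟨i, hi, hiD⟩ := h1 γ k rfl rfl fun i hi => hstep i (by omega)
  obtain ⟨j, hj, hjD⟩ := h2 (fun j => γ (k + j)) (m - k) rfl (congrArg γ (by omega))
    fun j hj => hstep (k + j) (by omega)
  obtain ⟨l, -, hlD⟩ := h3 β n hβ0 hβn fun i hi => Or.inr (hβ i hi)
  refine ⟨β l, hβS l, ?_⟩
  have hij := hnear hiD hjD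
  have hil := hnear hiD hlD
  have htri := wordDist_triangle hgen (γ k) (γ i) (β l)
  rw [wordDist_comm hgen (γ k) (γ i), hγ.wordDist_eq hi hk] at htri
  rw [hγ.wordDist_eq (by omega) (by omega)] at hij
  omega

end WordMetric

/-- In a finitely generated virtually free group `G` with finite generating set `A`,
a subgroup `H` is quasi-convex with respect to `A` if and only if it is finitely
generated. -/
theorem quasiconvex_iff_fg_of_virtuallyFree {G : Type*} [Group G]
    (A : Set G) (hA : A.Finite) (hgen : Subgroup.closure A = ⊤)
    (hVF : VirtuallyFree G) (H : Subgroup G) :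
    (∃ q : ℝ, 0 ≤ q ∧ ∀ (γ : ℕ → G) (m : ℕ), IsDiscGeodesic A γ m →
        γ 0 ∈ H → γ m ∈ H → ∀ i ≤ m, ∃ h ∈ H, (wordDist A (γ i) h : ℝ) ≤ q)
      ↔ H.FG := by
  constructor
  · rintro ⟨q, -, hq⟩
    refine fg_of_forall_isDiscGeodesic hA hgen (N := ⌊q⌋₊) fun γ m hγ h0 hm i hi => ?_
    obtain ⟨h, hh, hd⟩ := hq γ m hγ h0 hm i hi
    exact ⟨h, hh, Nat.le_floor hd⟩
  · intro hH
    obtain ⟨N, hN⟩ := hVF.exists_wordDist_le_of_fg hA hgen hH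
    refine ⟨N, Nat.cast_nonneg N, fun γ m hγ h0 hm i hi => ?_⟩
    obtain ⟨h, hh, hd⟩ := hN γ m hγ h0 hm i hi
    exact ⟨h, hh, Nat.cast_le.mpr hd⟩
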